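/- arXiv:2604.01170 — 2 statements merged into one kernel-verified Lean document; each statement's English description precedes it below -/
import Mathlib

section
/- (Discrete probability integral transform is super-uniform.) Let K be an integer-valued random variable with cumulative distribution function F(k) = P(K ≤ k), and let K' be an integer-valued random variable that stochastically dominates K, i.e. P(K' ≤ k) ≤ P(K ≤ k) for every integer k. Then the random variable p := F(K') is super-uniform: P(F(K') ≤ α) ≤ α for every α ∈ [0,1]. -/
open MeasureTheory

/-- Discrete probability integral transform is super-uniform.
Let `K` be an integer-valued random variable with CDF `F k = P(K ≤ k)`, and let `K'`
be an integer-valued random variable stochastically dominating `K`, i.e.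
`P(K' ≤ k) ≤ P(K ≤ k)` for every integer `k`.  Then `p := F (K')` is super-uniform:
`P(F (K') ≤ α) ≤ α` for every `α ∈ [0,1]`. -/
theorem discrete_pit_superuniform
    {Ω : Type*} [MeasurableSpace Ω] (P : Measure Ω) [IsProbabilityMeasure P]
    (K K' : Ω → ℤ) (hK : Measurable K) (hK' : Measurable K')
    (F : ℤ → ℝ) (hF : ∀ k, F k = (P {ω | K ω ≤ k}).toReal)
    (hdom : ∀ k : ℤ, P {ω | K' ω ≤ k} ≤ P {ω | K ω ≤ k}) :
    ∀ α : ℝ, 0 ≤ α → α ≤ 1 →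
      P {ω | F (K' ω) ≤ α} ≤ ENNReal.ofReal α := by
  intro α hα _
  have hU : {ω | F (K' ω) ≤ α} = ⋃ n : ℕ, {ω | K' ω ≤ (n : ℤ) ∧ F (K' ω) ≤ α} := by
    ext ω
    simp only [Set.mem_setOf_eq, Set.mem_iUnion]
    constructor
    · intro h
      exact ⟨(K' ω).toNat, Int.self_le_toNat _, h⟩
    · rintro ⟨_, _, h⟩
      exact h
  have hmono : Monotone (fun n : ℕ => {ω | K' ω ≤ (n : ℤ) ∧ F (K' ω) ≤ α}) := by
    intro m n hmn ω h
    exact ⟨h.1.trans (by exact_mod_cast hmn), h.2⟩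
  rw [hU, hmono.measure_iUnion]
  refine iSup_le fun n => ?_
  by_cases hex : ∃ k : ℤ, k ≤ (n : ℤ) ∧ F k ≤ α
  · obtain ⟨k, ⟨_, hk⟩, hmax⟩ := Int.exists_greatest_of_bdd
      (P := fun k : ℤ => k ≤ (n : ℤ) ∧ F k ≤ α) ⟨n, fun z hz => hz.1⟩ hex
    calc P {ω | K' ω ≤ (n : ℤ) ∧ F (K' ω) ≤ α} ≤ P {ω | K' ω ≤ k} :=
          measure_mono fun ω h => hmax _ h
      _ ≤ P {ω | K ω ≤ k} := hdom k
      _ = ENNReal.ofReal (F k) := by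
          rw [hF, ENNReal.ofReal_toReal (measure_ne_top _ _)]
      _ ≤ ENNReal.ofReal α := ENNReal.ofReal_le_ofReal hk
  · have : {ω | K' ω ≤ (n : ℤ) ∧ F (K' ω) ≤ α} = ∅ := by
      ext ω
      simp only [Set.mem_setOf_eq, Set.mem_empty_iff_false, iff_false]
      exact fun h => hex ⟨_, h⟩
    rw [this]
    simp
end

section
/- (General bounded risks: risk control from arbitrary super-uniform p-values.) Let δ ∈ (0,1) and ε ∈ (0,1). Fix a finite grid of indices j = 1, …, m with associated deployment risks r(j) ∈ [0,1] (deterministic numbers), and let p_1, …, p_m be random variables in [0,1] such that for every j with r(j) ≥ δ, the p-value p_j is super-uniform: P(p_j ≤ α) ≤ α for all α ∈ [0,1]. Apply fixed-sequence testing at level ε: test H_1 : r(1) ≥ δ, H_2 : r(2) ≥ δ, … in order, reject H_j if p_j ≤ ε, and stop at the first index with p_j > ε; let ĵ be the largest rejected index (ĵ = 0 if none). Then with probability at least 1 − ε, every rejected index j ∈ {1, …, ĵ} satisfies r(j) < δ; in particular, P({ĵ = 0} ∪ {r(ĵ) ≤ δ}) ≥ 1 − ε. -/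
open MeasureTheory

/-- General bounded risks: risk control from arbitrary super-uniform p-values.
Fix `δ, ε ∈ (0,1)`, deterministic deployment risks `r j ∈ [0,1]` for `j = 1, …, m`,
and p-values `p j` with values in `[0,1]` such that `p j` is super-uniform whenever
`r j ≥ δ`.  Apply fixed-sequence testing at level `ε` (reject `H j : r j ≥ δ` iff
`p k ≤ ε` for all `k ≤ j`).  Then with probability at least `1 − ε`, every rejected
index `j` satisfies `r j < δ`. -/
theorem fixed_sequence_risk_control_superuniform
    {Ω : Type*} [MeasurableSpace Ω] (P : Measure Ω) [IsProbabilityMeasure P]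
    (δ ε : ℝ) (hδ : δ ∈ Set.Ioo (0 : ℝ) 1) (hε : ε ∈ Set.Ioo (0 : ℝ) 1)
    (m : ℕ) (r : Fin m → ℝ) (hr : ∀ j, r j ∈ Set.Icc (0 : ℝ) 1)
    (p : Fin m → Ω → ℝ) (hpmeas : ∀ j, Measurable (p j))
    (hpval : ∀ j ω, p j ω ∈ Set.Icc (0 : ℝ) 1)
    (hsup : ∀ j, δ ≤ r j → ∀ α : ℝ, 0 ≤ α → α ≤ 1 →
      P {ω | p j ω ≤ α} ≤ ENNReal.ofReal α) :
    P {ω | ∀ j : Fin m, (∀ k ≤ j, p k ω ≤ ε) → r j < δ}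
      ≥ 1 - ENNReal.ofReal ε := by
  by_cases h : ∃ j, δ ≤ r j
  · -- the first true null `j₀`
    obtain ⟨j₀, hj₀, hmin⟩ : ∃ j₀, δ ≤ r j₀ ∧ ∀ j, δ ≤ r j → j₀ ≤ j := by
      classical
      have hne : (Finset.univ.filter (fun j => δ ≤ r j)).Nonempty := by
        obtain ⟨j, hj⟩ := h
        exact ⟨j, by simpa using hj⟩
      refine ⟨(Finset.univ.filter (fun j => δ ≤ r j)).min' hne, ?_, ?_⟩
      · simpa using Finset.min'_mem _ hne
      · intro j hj
        exact Finset.min'_le _ _ (by simpa using hj)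
    have hms : MeasurableSet {ω | p j₀ ω ≤ ε} := measurableSet_le (hpmeas j₀) measurable_const
    have hsub : {ω | p j₀ ω ≤ ε}ᶜ ⊆
        {ω | ∀ j : Fin m, (∀ k ≤ j, p k ω ≤ ε) → r j < δ} := by
      intro ω hω j hj
      by_contra hc
      exact hω (hj j₀ (hmin j (not_lt.mp hc)))
    calc 1 - ENNReal.ofReal ε ≤ 1 - P {ω | p j₀ ω ≤ ε} :=
          tsub_le_tsub_left (hsup j₀ hj₀ ε hε.1.le hε.2.le) 1
      _ = P {ω | p j₀ ω ≤ ε}ᶜ := (prob_compl_eq_one_sub hms).symm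
      _ ≤ _ := measure_mono hsub
  · push Not at h
    have hu : {ω | ∀ j : Fin m, (∀ k ≤ j, p k ω ≤ ε) → r j < δ} = Set.univ :=
      Set.eq_univ_of_forall fun ω j _ => h j
    rw [hu, measure_univ]
    exact tsub_le_self
end
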